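/- arXiv:1205.0743 — 8 statements merged into one kernel-verified Lean document; each statement's English description precedes it below -/
import Mathlib

section
/- Let ε ∈ {1, -1} and let M_ε be the 6×6 integer matrix with rows (0,-1,-1,-1,-1,0), (0,2,0,0,0,1), (0,0,2,0,0,ε), (0,0,0,2,0,-ε), (0,0,0,0,2,-1), (0,0,0,0,0,0). Then the kernel of the ℤ-linear map ℤ^6 → ℤ^6 determined by M_ε is a free ℤ-module of rank 2, i.e. it is isomorphic to ℤ². -/
/-- The kernel is the graph over the coordinates `v 0` and `v 1`. -/
theorem mem_ker_iff (ε : ℤ) (v : Fin 6 → ℤ) :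
    v ∈ LinearMap.ker (Matrix.mulVecLin
      (!![0,-1,-1,-1,-1, 0;
          0, 2, 0, 0, 0, 1;
          0, 0, 2, 0, 0, ε;
          0, 0, 0, 2, 0,-ε;
          0, 0, 0, 0, 2,-1;
          0, 0, 0, 0, 0, 0] : Matrix (Fin 6) (Fin 6) ℤ)) ↔
      v 2 = ε * v 1 ∧ v 3 = -(ε * v 1) ∧ v 4 = -v 1 ∧ v 5 = -2 * v 1 := by
  rw [LinearMap.mem_ker, Matrix.mulVecLin_apply, funext_iff]
  simp only [Fin.forall_fin_succ, Matrix.mulVec, dotProduct, Fin.sum_univ_succ]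
  simp
  constructor
  · rintro ⟨-, h₁, h₂, h₃, h₄⟩
    have h₅ : v 5 = -2 * v 1 := by linarith
    rw [h₅] at h₂ h₃ h₄
    exact ⟨by linarith, by linarith, by linarith, by linarith⟩
  · rintro ⟨h₂, h₃, h₄, h₅⟩
    rw [h₂, h₃, h₄, h₅]
    refine ⟨?_, ?_, ?_, ?_, ?_⟩ <;> ring

/-- The kernel of the ℤ-linear map ℤ⁶ → ℤ⁶ given by the matrix of `id − β̂_*` on
`K₀(C(T²_θ) ⋊ ℤ₂)` is free of rank 2, i.e. isomorphic to ℤ², for ε = ±1. -/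
theorem stmt_0 (ε : ℤ) (hε : ε = 1 ∨ ε = -1) :
    Nonempty (LinearMap.ker (Matrix.mulVecLin
      (!![0,-1,-1,-1,-1, 0;
          0, 2, 0, 0, 0, 1;
          0, 0, 2, 0, 0, ε;
          0, 0, 0, 2, 0,-ε;
          0, 0, 0, 0, 2,-1;
          0, 0, 0, 0, 0, 0] : Matrix (Fin 6) (Fin 6) ℤ))
      ≃ₗ[ℤ] (Fin 2 → ℤ)) := by
  refine ⟨{
    toFun := fun v => ![v.1 0, v.1 1]
    map_add' := fun v w => by ext i; fin_cases i <;> rfl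
    map_smul' := fun c v => by ext i; fin_cases i <;> rfl
    invFun := fun w => ⟨![w 0, w 1, ε * w 1, -(ε * w 1), -w 1, -2 * w 1],
      (mem_ker_iff ε _).2 ⟨rfl, rfl, rfl, rfl⟩⟩
    left_inv := fun v => ?_
    right_inv := fun w => by ext i; fin_cases i <;> rfl }⟩
  obtain ⟨h₂, h₃, h₄, h₅⟩ := (mem_ker_iff ε _).1 v.2
  ext i
  fin_cases i
  exacts [rfl, rfl, h₂.symm, h₃.symm, h₄.symm, h₅.symm]
end

section
/- Let M be the 8×8 integer matrix with rows (0,0,-1,0,-1,0,-1,-1), (0,1,1,0,0,0,0,0), (0,-1,2,0,0,0,0,1), (0,0,0,1,1,0,0,0), (0,0,0,-1,2,0,0,1), (0,0,0,0,0,1,1,0), (0,0,0,0,0,-1,2,1), (0,0,0,0,0,0,0,0). Then the kernel of the ℤ-linear map ℤ^8 → ℤ^8 determined by M is a free ℤ-module of rank 2, i.e. isomorphic to ℤ². -/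
/-- The kernel of the ℤ-linear map ℤ⁸ → ℤ⁸ given by the matrix of `id − β̂_*` on
`K₀(C(T²_θ) ⋊ ℤ₃)` is free of rank 2, i.e. isomorphic to ℤ². -/
theorem stmt_3 :
    Nonempty (LinearMap.ker (Matrix.mulVecLin
      (!![0, 0,-1, 0,-1, 0,-1,-1;
          0, 1, 1, 0, 0, 0, 0, 0;
          0,-1, 2, 0, 0, 0, 0, 1;
          0, 0, 0, 1, 1, 0, 0, 0;
          0, 0, 0,-1, 2, 0, 0, 1;
          0, 0, 0, 0, 0, 1, 1, 0;
          0, 0, 0, 0, 0,-1, 2, 1;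
          0, 0, 0, 0, 0, 0, 0, 0] : Matrix (Fin 8) (Fin 8) ℤ))
      ≃ₗ[ℤ] (Fin 2 → ℤ)) := by
  refine ⟨LinearEquiv.ofBijective ((LinearMap.funLeft ℤ ℤ ![0, 2]).comp (Submodule.subtype _))
    ⟨?_, fun v => ⟨⟨![v 0, -v 1, v 1, -v 1, v 1, -v 1, v 1, -3 * v 1], ?_⟩, ?_⟩⟩⟩
  · rw [← LinearMap.ker_eq_bot, LinearMap.ker_eq_bot']
    rintro ⟨x, hx⟩ h
    have h0 := congrFun h 0
    have h1 := congrFun h 1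
    simp [LinearMap.funLeft] at h0 h1
    simp [dotProduct, funext_iff, Fin.forall_fin_succ, Fin.sum_univ_succ] at hx
    ext i
    fin_cases i <;> simp <;> grind
  · simp [funext_iff, Fin.forall_fin_succ]
    grind
  · ext i
    fin_cases i <;> simp [LinearMap.funLeft]
end

section
/- Let M be the 8×8 integer matrix with rows (0,0,-1,0,-1,0,-1,-1), (0,1,1,0,0,0,0,0), (0,-1,2,0,0,0,0,1), (0,0,0,1,1,0,0,0), (0,0,0,-1,2,0,0,1), (0,0,0,0,0,1,1,0), (0,0,0,0,0,-1,2,1), (0,0,0,0,0,0,0,0). Then the cokernel ℤ^8 / M(ℤ^8) of the ℤ-linear map determined by M is isomorphic, as a ℤ-module, to ℤ² ⊕ (ℤ/3ℤ). -/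
/-- The surjection `ℤ⁸ → ℤ² ⊕ ℤ/3` whose kernel is the range of the matrix of `id − β̂_*`. -/
def cokernelProjection : (Fin 8 → ℤ) →ₗ[ℤ] ((Fin 2 → ℤ) × ZMod 3) :=
  AddMonoidHom.toIntLinearMap
    { toFun := fun y =>
        (![3 * y 0 + y 1 + y 2 + y 3 + y 4 + y 5 + y 6, y 7],
          ((y 3 + y 4 - y 5 - y 6 : ℤ) : ZMod 3))
      map_zero' := by
        ext i
        · fin_cases i <;> simp
        · simp
      map_add' := fun x y => by
        ext i
        · fin_cases i
          · simp
            ring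
          · simp
        · simp
          ring }

theorem cokernelProjection_apply (y : Fin 8 → ℤ) :
    cokernelProjection y =
      (![3 * y 0 + y 1 + y 2 + y 3 + y 4 + y 5 + y 6, y 7],
        ((y 3 + y 4 - y 5 - y 6 : ℤ) : ZMod 3)) :=
  rfl

theorem cokernelProjection_surjective : Function.Surjective cokernelProjection := by
  rintro ⟨u, z⟩
  obtain ⟨w, rfl⟩ := ZMod.intCast_surjective z
  refine ⟨![0, u 0 - w, 0, w, 0, 0, 0, u 1], ?_⟩
  rw [cokernelProjection_apply]
  ext i
  · fin_cases i <;> simp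
  · simp

theorem mem_ker_cokernelProjection_iff (y : Fin 8 → ℤ) :
    y ∈ LinearMap.ker cokernelProjection ↔
      3 * y 0 + y 1 + y 2 + y 3 + y 4 + y 5 + y 6 = 0 ∧ y 7 = 0 ∧
        (3 : ℤ) ∣ y 3 + y 4 - y 5 - y 6 := by
  rw [LinearMap.mem_ker, cokernelProjection_apply, Prod.mk_eq_zero,
    ZMod.intCast_zmod_eq_zero_iff_dvd, funext_iff, Fin.forall_fin_two]
  simp [and_assoc]


/-- The cokernel of the ℤ-linear map ℤ⁸ → ℤ⁸ given by the matrix of `id − β̂_*` on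
`K₀(C(T²_θ) ⋊ ℤ₃)` is isomorphic to ℤ² ⊕ ℤ/3. -/
theorem stmt_4 :
    Nonempty (((Fin 8 → ℤ) ⧸ LinearMap.range (Matrix.mulVecLin
      (!![0, 0,-1, 0,-1, 0,-1,-1;
          0, 1, 1, 0, 0, 0, 0, 0;
          0,-1, 2, 0, 0, 0, 0, 1;
          0, 0, 0, 1, 1, 0, 0, 0;
          0, 0, 0,-1, 2, 0, 0, 1;
          0, 0, 0, 0, 0, 1, 1, 0;
          0, 0, 0, 0, 0,-1, 2, 1;
          0, 0, 0, 0, 0, 0, 0, 0] : Matrix (Fin 8) (Fin 8) ℤ)))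
      ≃ₗ[ℤ] ((Fin 2 → ℤ) × ZMod 3)) := by
  refine ⟨(Submodule.quotEquivOfEq _ _ ?_).trans
    (cokernelProjection.quotKerEquivOfSurjective cokernelProjection_surjective)⟩
  ext y
  rw [mem_ker_cokernelProjection_iff, LinearMap.mem_range]
  constructor
  · rintro ⟨x, rfl⟩
    simp only [Matrix.mulVecLin_apply, Matrix.mulVec, dotProduct, Fin.sum_univ_eight]
    simp
    refine ⟨by ring, x 4 - x 6, by ring⟩
  · rintro ⟨hsum, hlast, k, hk⟩
    refine ⟨![0, y 1 + y 0 + k + y 5 + y 6, -y 0 - k - y 5 - y 6, y 3 - k, k, y 5, 0,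
      y 5 + y 6], ?_⟩
    ext i
    simp only [Matrix.mulVecLin_apply, Matrix.mulVec, dotProduct, Fin.sum_univ_eight]
    fin_cases i <;> simp <;> linarith
end

section
/- Let M be the 9×9 integer matrix with rows (0,0,0,-1,0,0,-1,-1,-1), (0,1,0,1,0,0,0,0,0), (0,-1,1,1,0,0,0,0,0), (0,0,-1,2,0,0,0,0,1), (0,0,0,0,1,0,1,0,0), (0,0,0,0,-1,1,1,0,0), (0,0,0,0,0,-1,2,0,1), (0,0,0,0,0,0,0,2,1), (0,0,0,0,0,0,0,0,0). Then the kernel of the ℤ-linear map ℤ^9 → ℤ^9 determined by M is a free ℤ-module of rank 2, i.e. isomorphic to ℤ². -/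
/-- The kernel of the ℤ-linear map ℤ⁹ → ℤ⁹ given by the matrix of `id − β̂_*` on
`K₀(C(T²_θ) ⋊ ℤ₄)` is free of rank 2, i.e. isomorphic to ℤ². -/
theorem stmt_5 :
    Nonempty (LinearMap.ker (Matrix.mulVecLin
      (!![0, 0, 0,-1, 0, 0,-1,-1,-1;
          0, 1, 0, 1, 0, 0, 0, 0, 0;
          0,-1, 1, 1, 0, 0, 0, 0, 0;
          0, 0,-1, 2, 0, 0, 0, 0, 1;
          0, 0, 0, 0, 1, 0, 1, 0, 0;
          0, 0, 0, 0,-1, 1, 1, 0, 0;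
          0, 0, 0, 0, 0,-1, 2, 0, 1;
          0, 0, 0, 0, 0, 0, 0, 2, 1;
          0, 0, 0, 0, 0, 0, 0, 0, 0] : Matrix (Fin 9) (Fin 9) ℤ))
      ≃ₗ[ℤ] (Fin 2 → ℤ)) := by
  refine ⟨LinearEquiv.ofBijective
    ((LinearMap.funLeft ℤ ℤ ![0, 3]).comp (Submodule.subtype _)) ⟨?_, fun y => ?_⟩⟩
  · refine (injective_iff_map_eq_zero _).2 fun ⟨x, hx⟩ h => Subtype.ext ?_
    have h0 : x 0 = 0 := congrFun h 0
    have h3 : x 3 = 0 := congrFun h 1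
    rw [LinearMap.mem_ker, funext_iff] at hx
    simp [Fin.forall_fin_succ, Matrix.mulVec, dotProduct, Fin.sum_univ_succ] at hx
    ext i
    fin_cases i <;> simp <;> lia
  · refine ⟨⟨![y 0, -y 1, -2 * y 1, y 1, -y 1, -2 * y 1, y 1, 2 * y 1, -4 * y 1], ?_⟩, ?_⟩
    · rw [LinearMap.mem_ker]
      ext i
      fin_cases i <;>
        simp [Matrix.mulVec, dotProduct, Fin.sum_univ_succ] <;> ring
    · ext i
      fin_cases i <;> rfl
end

section
/- Let M be the 9×9 integer matrix with rows (0,0,0,-1,0,0,-1,-1,-1), (0,1,0,1,0,0,0,0,0), (0,-1,1,1,0,0,0,0,0), (0,0,-1,2,0,0,0,0,1), (0,0,0,0,1,0,1,0,0), (0,0,0,0,-1,1,1,0,0), (0,0,0,0,0,-1,2,0,1), (0,0,0,0,0,0,0,2,1), (0,0,0,0,0,0,0,0,0). Then the cokernel ℤ^9 / M(ℤ^9) of the ℤ-linear map determined by M is isomorphic, as a ℤ-module, to ℤ² ⊕ (ℤ/2ℤ). -/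
/-- The ℤ-linear map ℤ⁹ → ℤ² ⊕ ℤ/2 whose kernel is the range of the matrix of `id − β̂_*`:
the two integral coordinates and the mod-2 coordinate of a class in the cokernel. -/
def cokernelCoordinates : (Fin 9 → ℤ) →ₗ[ℤ] ((Fin 2 → ℤ) × ZMod 2) where
  toFun v :=
    (![4 * v 0 + v 1 + v 2 + v 3 + v 4 + v 5 + v 6 + 2 * v 7, v 8],
      ((v 1 + v 2 + v 3 + v 7 : ℤ) : ZMod 2))
  map_add' v w := by
    refine Prod.ext ?_ ?_
    · funext i
      fin_cases i
      · simp
        ring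
      · simp
    · simp
      ring
  map_smul' c v := by
    refine Prod.ext ?_ ?_
    · funext i
      fin_cases i
      · simp
        ring
      · simp
    · simp

theorem mem_ker_cokernelCoordinates {v : Fin 9 → ℤ} :
    v ∈ LinearMap.ker cokernelCoordinates ↔
      4 * v 0 + v 1 + v 2 + v 3 + v 4 + v 5 + v 6 + 2 * v 7 = 0 ∧ v 8 = 0 ∧
        (2 : ℤ) ∣ v 1 + v 2 + v 3 + v 7 := by
  have h := ZMod.intCast_zmod_eq_zero_iff_dvd (v 1 + v 2 + v 3 + v 7) 2
  rw [LinearMap.mem_ker, Prod.ext_iff, funext_iff, Fin.forall_fin_two, and_assoc]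
  exact and_congr Iff.rfl (and_congr Iff.rfl h)

theorem cokernelCoordinates_surjective : Function.Surjective cokernelCoordinates := by
  rintro ⟨a, c⟩
  obtain ⟨n, rfl⟩ := ZMod.intCast_surjective c
  refine ⟨![0, n, 0, 0, a 0 - n, 0, 0, 0, a 1], Prod.ext ?_ ?_⟩
  · funext i
    fin_cases i <;> simp [cokernelCoordinates]
  · simp [cokernelCoordinates]


/-- The cokernel of the ℤ-linear map ℤ⁹ → ℤ⁹ given by the matrix of `id − β̂_*` on
`K₀(C(T²_θ) ⋊ ℤ₄)` is isomorphic to ℤ² ⊕ ℤ/2. -/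
theorem stmt_6 :
    Nonempty (((Fin 9 → ℤ) ⧸ LinearMap.range (Matrix.mulVecLin
      (!![0, 0, 0,-1, 0, 0,-1,-1,-1;
          0, 1, 0, 1, 0, 0, 0, 0, 0;
          0,-1, 1, 1, 0, 0, 0, 0, 0;
          0, 0,-1, 2, 0, 0, 0, 0, 1;
          0, 0, 0, 0, 1, 0, 1, 0, 0;
          0, 0, 0, 0,-1, 1, 1, 0, 0;
          0, 0, 0, 0, 0,-1, 2, 0, 1;
          0, 0, 0, 0, 0, 0, 0, 2, 1;
          0, 0, 0, 0, 0, 0, 0, 0, 0] : Matrix (Fin 9) (Fin 9) ℤ)))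
      ≃ₗ[ℤ] ((Fin 2 → ℤ) × ZMod 2)) := by
  refine ⟨(Submodule.quotEquivOfEq _ _ ?_).trans
    (cokernelCoordinates.quotKerEquivOfSurjective cokernelCoordinates_surjective)⟩
  ext v
  rw [mem_ker_cokernelCoordinates]
  constructor
  · rintro ⟨w, rfl⟩
    simp [Matrix.mulVec, dotProduct, Fin.sum_univ_succ]
    lia
  · rintro ⟨h, h8, k, hk⟩
    refine ⟨![0, v 1, v 1 + v 2, 0, v 4 + v 0 + k, v 5 + v 4 + 2 * (v 0 + k), -(v 0 + k),
      k - (v 1 + v 2 + v 3), v 1 + v 2 + v 3], ?_⟩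
    funext i
    fin_cases i <;> simp [Matrix.mulVec, dotProduct, Fin.sum_univ_succ] <;> lia
end

section
/- Let M be the 10×10 integer matrix with rows (0,0,0,0,0,-1,0,-1,-1,-1), (0,1,0,0,0,1,0,0,0,0), (0,-1,1,0,0,1,0,0,0,0), (0,0,-1,1,0,1,0,0,0,0), (0,0,0,-1,1,1,0,0,0,0), (0,0,0,0,-1,2,0,0,0,1), (0,0,0,0,0,0,1,1,0,0), (0,0,0,0,0,0,-1,2,0,1), (0,0,0,0,0,0,0,0,2,1), (0,0,0,0,0,0,0,0,0,0). Then the kernel of the ℤ-linear map ℤ^10 → ℤ^10 determined by M is a free ℤ-module of rank 2, i.e. isomorphic to ℤ². -/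
/-- The vectors parametrising the kernel of the matrix: the coordinates at `0` and `5` are free. -/
def kernelVector (c : Fin 2 → ℤ) : Fin 10 → ℤ :=
  ![c 0, -c 1, -2 * c 1, -3 * c 1, -4 * c 1, c 1, -2 * c 1, 2 * c 1, 3 * c 1, -6 * c 1]

/-- A vector lies in the kernel iff it is determined by its coordinates at `0` and `5`. -/
theorem mulVec_eq_zero_iff_eq_kernelVector (x : Fin 10 → ℤ) :
    Matrix.mulVec
      (!![0, 0, 0, 0, 0,-1, 0,-1,-1,-1;
          0, 1, 0, 0, 0, 1, 0, 0, 0, 0;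
          0,-1, 1, 0, 0, 1, 0, 0, 0, 0;
          0, 0,-1, 1, 0, 1, 0, 0, 0, 0;
          0, 0, 0,-1, 1, 1, 0, 0, 0, 0;
          0, 0, 0, 0,-1, 2, 0, 0, 0, 1;
          0, 0, 0, 0, 0, 0, 1, 1, 0, 0;
          0, 0, 0, 0, 0, 0,-1, 2, 0, 1;
          0, 0, 0, 0, 0, 0, 0, 0, 2, 1;
          0, 0, 0, 0, 0, 0, 0, 0, 0, 0] : Matrix (Fin 10) (Fin 10) ℤ) x = 0 ↔
      x = kernelVector ![x 0, x 5] := by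
  simp only [funext_iff, kernelVector, Fin.forall_fin_succ, Matrix.mulVec, dotProduct,
    Fin.sum_univ_succ]
  simp
  omega

/-- The kernel of the ℤ-linear map ℤ¹⁰ → ℤ¹⁰ given by the matrix of `id − β̂_*` on
`K₀(C(T²_θ) ⋊ ℤ₆)` is free of rank 2, i.e. isomorphic to ℤ². -/
theorem stmt_7 :
    Nonempty (LinearMap.ker (Matrix.mulVecLin
      (!![0, 0, 0, 0, 0,-1, 0,-1,-1,-1;
          0, 1, 0, 0, 0, 1, 0, 0, 0, 0;
          0,-1, 1, 0, 0, 1, 0, 0, 0, 0;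
          0, 0,-1, 1, 0, 1, 0, 0, 0, 0;
          0, 0, 0,-1, 1, 1, 0, 0, 0, 0;
          0, 0, 0, 0,-1, 2, 0, 0, 0, 1;
          0, 0, 0, 0, 0, 0, 1, 1, 0, 0;
          0, 0, 0, 0, 0, 0,-1, 2, 0, 1;
          0, 0, 0, 0, 0, 0, 0, 0, 2, 1;
          0, 0, 0, 0, 0, 0, 0, 0, 0, 0] : Matrix (Fin 10) (Fin 10) ℤ))
      ≃ₗ[ℤ] (Fin 2 → ℤ)) := by
  refine ⟨{ toFun := fun x => ![x.1 0, x.1 5]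
            map_add' := fun x y => by ext i; fin_cases i <;> rfl
            map_smul' := fun r x => by ext i; fin_cases i <;> rfl
            invFun := fun c => ⟨kernelVector c, ?_⟩
            left_inv := fun x => Subtype.ext
              ((mulVec_eq_zero_iff_eq_kernelVector x.1).1 x.2).symm
            right_inv := fun c => by ext i; fin_cases i <;> rfl }⟩
  exact (mulVec_eq_zero_iff_eq_kernelVector _).2 rfl
end

section
/- Let M be the 10×10 integer matrix with rows (0,0,0,0,0,-1,0,-1,-1,-1), (0,1,0,0,0,1,0,0,0,0), (0,-1,1,0,0,1,0,0,0,0), (0,0,-1,1,0,1,0,0,0,0), (0,0,0,-1,1,1,0,0,0,0), (0,0,0,0,-1,2,0,0,0,1), (0,0,0,0,0,0,1,1,0,0), (0,0,0,0,0,0,-1,2,0,1), (0,0,0,0,0,0,0,0,2,1), (0,0,0,0,0,0,0,0,0,0). Then the cokernel ℤ^10 / M(ℤ^10) of the ℤ-linear map determined by M is isomorphic, as a ℤ-module, to ℤ² (in particular it is torsion-free). -/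
/-- If `φ : M → N` is surjective with kernel the range of `f`, the cokernel of `f` is `N`. -/
theorem nonempty_quotient_range_linearEquiv {R L M N : Type*} [Ring R]
    [AddCommGroup L] [AddCommGroup M] [AddCommGroup N] [Module R L] [Module R M] [Module R N]
    {f : L →ₗ[R] M} {φ : M →ₗ[R] N} (hf : Function.Exact f φ) (hφ : Function.Surjective φ) :
    Nonempty ((M ⧸ LinearMap.range f) ≃ₗ[R] N) :=
  ⟨(Submodule.quotEquivOfEq _ _ hf.linearMap_ker_eq.symm).trans
    (φ.quotKerEquivOfSurjective hφ)⟩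

/-- The cokernel of the ℤ-linear map ℤ¹⁰ → ℤ¹⁰ given by the matrix of `id − β̂_*` on
`K₀(C(T²_θ) ⋊ ℤ₆)` is isomorphic to ℤ² (in particular torsion-free). -/
theorem stmt_8 :
    Nonempty (((Fin 10 → ℤ) ⧸ LinearMap.range (Matrix.mulVecLin
      (!![0, 0, 0, 0, 0,-1, 0,-1,-1,-1;
          0, 1, 0, 0, 0, 1, 0, 0, 0, 0;
          0,-1, 1, 0, 0, 1, 0, 0, 0, 0;
          0, 0,-1, 1, 0, 1, 0, 0, 0, 0;
          0, 0, 0,-1, 1, 1, 0, 0, 0, 0;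
          0, 0, 0, 0,-1, 2, 0, 0, 0, 1;
          0, 0, 0, 0, 0, 0, 1, 1, 0, 0;
          0, 0, 0, 0, 0, 0,-1, 2, 0, 1;
          0, 0, 0, 0, 0, 0, 0, 0, 2, 1;
          0, 0, 0, 0, 0, 0, 0, 0, 0, 0] : Matrix (Fin 10) (Fin 10) ℤ)))
      ≃ₗ[ℤ] (Fin 2 → ℤ)) := by
  refine nonempty_quotient_range_linearEquiv (φ := Matrix.mulVecLin
    (!![6, 1, 1, 1, 1, 1, 2, 2, 3, 0;
        0, 0, 0, 0, 0, 0, 0, 0, 0, 1] : Matrix (Fin 2) (Fin 10) ℤ)) ?_ ?_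
  · intro y
    constructor
    · intro h
      have h0 := congrFun h 0
      have h1 := congrFun h 1
      simp [Matrix.mulVec, dotProduct, Fin.sum_univ_succ] at h0 h1
      let s := y 6 + y 7
      let a := -y 0 - s - y 8
      refine ⟨![0, y 1 - a, y 1 + y 2 - 2 * a, y 1 + y 2 + y 3 - 3 * a,
        y 1 + y 2 + y 3 + y 4 - 4 * a, a, y 6 + s + y 8, -s - y 8, -2 * s - y 8,
        4 * s + 3 * y 8], ?_⟩
      ext i
      fin_cases i <;> simp [Matrix.mulVec, dotProduct, Fin.sum_univ_succ, a, s] <;> lia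
    · rintro ⟨x, rfl⟩
      ext i
      fin_cases i <;> simp [Matrix.mulVec, dotProduct, Fin.sum_univ_succ] <;> ring
  · intro z
    refine ⟨![0, z 0, 0, 0, 0, 0, 0, 0, 0, z 1], ?_⟩
    ext i
    fin_cases i <;> simp [Matrix.mulVec, dotProduct, Fin.sum_univ_succ]
end

section
/- Let A be an associative ℂ-algebra, N ≥ 1, and σ an algebra automorphism of A with σ^N = id. Fix s with 0 < s ≤ N and let Φ : A → ℂ be a linear functional that is σ-invariant and σ^s-twisted tracial, i.e. Φ(σ(a)) = Φ(a) and Φ(ab) = Φ(σ^s(b) a) for all a, b ∈ A. Model the algebraic crossed product A ⋊ ℤ_N as the space of functions f : ℤ/Nℤ → A with the twisted convolution product (f ⋆ g)(n) = ∑_{k+j ≡ n (mod N)} f(k) · σ^k(g(j)). Define Φ̃(f) = Φ(f(N−s mod N)). Then Φ̃ is a trace on the crossed product: Φ̃(f ⋆ g) = Φ̃(g ⋆ f) for all f, g. -/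
theorem map_pow_eq_of_invariant {R A M : Type*} [CommSemiring R] [Semiring A] [Algebra R A]
    (σ : A ≃ₐ[R] A) (Φ : A → M) (hinv : ∀ a : A, Φ (σ a) = Φ a) (n : ℕ) (a : A) :
    Φ ((σ ^ n) a) = Φ a := by
  induction n with
  | zero => rfl
  | succ n ih => rw [pow_succ', AlgEquiv.mul_apply, hinv, ih]

/-- The trace property of the twisted trace on homogeneous elements `a e^k` and `b e^j` of
complementary degrees. -/
theorem twisted_trace_mul_comm {R A M : Type*} [CommSemiring R] [Semiring A] [Algebra R A]
    (σ : A ≃ₐ[R] A) (Φ : A → M) (s : ℕ) (hinv : ∀ a : A, Φ (σ a) = Φ a)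
    (htw : ∀ a b : A, Φ (a * b) = Φ ((σ ^ s) b * a)) {k j : ℕ} (h : σ ^ (j + s + k) = 1)
    (a b : A) : Φ (a * (σ ^ k) b) = Φ (b * (σ ^ j) a) := by
  rw [htw, ← map_pow_eq_of_invariant σ Φ hinv j, map_mul, ← AlgEquiv.mul_apply,
    ← AlgEquiv.mul_apply, ← pow_add, ← pow_add, h, AlgEquiv.one_apply]

open Finset in
/-- A `σ`-invariant, `σ^s`-twisted trace `Φ` on `A` extends to a trace
`Φ̃(f) = Φ(f(N−s))` on the crossed product `A ⋊ ℤ_N`, modelled as functions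
`ℤ/Nℤ → A` with twisted convolution `(f ⋆ g)(n) = ∑_k f(k)·σ^k(g(n−k))`. -/
theorem stmt_11 (A : Type*) [Ring A] [Algebra ℂ A] (N : ℕ) [NeZero N]
    (σ : A ≃ₐ[ℂ] A) (hσ : σ ^ N = 1)
    (s : ℕ) (hs0 : 0 < s) (hsN : s ≤ N)
    (Φ : A →ₗ[ℂ] ℂ)
    (hinv : ∀ a : A, Φ (σ a) = Φ a)
    (htw : ∀ a b : A, Φ (a * b) = Φ ((σ ^ s) b * a)) :
    ∀ f g : ZMod N → A,
      Φ ((∑ k : ZMod N, f k * (σ ^ (k.val)) (g (((N - s : ℕ) : ZMod N) - k)))) =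
      Φ ((∑ k : ZMod N, g k * (σ ^ (k.val)) (f (((N - s : ℕ) : ZMod N) - k)))) := by
  intro f g
  rw [map_sum, map_sum]
  refine Fintype.sum_equiv (Equiv.subLeft ((N - s : ℕ) : ZMod N)) _ _ fun k => ?_
  simp only [Equiv.subLeft_apply, sub_sub_cancel]
  refine twisted_trace_mul_comm σ Φ s hinv htw ?_ _ _
  refine orderOf_dvd_iff_pow_eq_one.mp ((orderOf_dvd_of_pow_eq_one hσ).trans ?_)
  rw [← ZMod.natCast_eq_zero_iff]
  simp [Nat.cast_sub hsN]
  ring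
end
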